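/- Let X and Y be disjoint node sets in an MPDAG G = (V,E) and suppose there is no proper possibly causal path from X to Y in G that starts with an undirected edge. Let (B_1,…,B_k), k ≥ 1, be the bucket decomposition of An(Y, G_{V∖X}) ordered as a partial causal ordering in G. For i ∈ {1,…,k}, let P_i = (∪_{j=1}^{i-1} B_j) ∩ Pa(B_i,G) (P_1 = ∅) and X_{p_i} = X ∩ Pa(B_i,G). Then for every DAG D in [G], B_i is d-separated from X_{p_i} given P_i in the graph D_{X_{p_i}} obtained from D by removing all edges out of X_{p_i}. -/

import Mathlib

open scoped Classical

noncomputable section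

/-- A partially directed graph on node type `V`: directed (`dir`) and undirected (`undir`)
edges, with at most one edge between any two nodes. -/
structure PDG (V : Type) where
  dir : V → V → Prop
  undir : V → V → Prop
  undir_symm : ∀ a b, undir a b → undir b a
  dir_irrefl : ∀ a, ¬ dir a a
  undir_irrefl : ∀ a, ¬ undir a a
  dir_asymm : ∀ a b, dir a b → ¬ dir b a
  dir_not_undir : ∀ a b, dir a b → ¬ undir a b

namespace PDG

variable {V : Type}

/-- Two nodes are adjacent if there is an edge between them. -/
def Adj (G : PDG V) (a b : V) : Prop := G.dir a b ∨ G.dir b a ∨ G.undir a b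

/-- No directed cycles. -/
def Acyclic (G : PDG V) : Prop := ∀ a, ¬ Relation.TransGen G.dir a a

/-- A maximally oriented PDAG (MPDAG): a partially directed graph with no directed
cycles, in which none of the four configurations of Meek's orientation rules occurs
as an induced subgraph. -/
structure IsMPDAG (G : PDG V) : Prop where
  acyclic : G.Acyclic
  meek1 : ∀ a b c, G.dir a b → G.undir b c → G.Adj a c
  meek2 : ∀ a b c, G.dir a b → G.dir b c → ¬ G.undir a c
  meek3 : ∀ i j k l, k ≠ l → G.undir i j → G.undir i k → G.undir i l →
      G.dir k j → G.dir l j → G.Adj k l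
  meek4 : ∀ i j k l, G.undir i j → G.undir i k → G.undir i l →
      G.dir j l → G.dir l k → G.Adj j k

/-- A DAG: only directed edges, no directed cycles. -/
def IsDAG (G : PDG V) : Prop := (∀ a b, ¬ G.undir a b) ∧ G.Acyclic

/-- `⟨a,b,c⟩` is an unshielded collider. -/
def UnshieldedCollider (G : PDG V) (a b c : V) : Prop :=
  a ≠ c ∧ G.dir a b ∧ G.dir c b ∧ ¬ G.Adj a c

/-- `D ∈ [G]` : `D` is a DAG represented by the MPDAG `G`: same adjacencies,
same unshielded colliders, containing every directed edge of `G`. -/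
def InClassOf (D G : PDG V) : Prop :=
  IsDAG D ∧ (∀ a b, G.Adj a b ↔ D.Adj a b) ∧
    (∀ a b c, G.UnshieldedCollider a b c ↔ D.UnshieldedCollider a b c) ∧
    (∀ a b, G.dir a b → D.dir a b)

/-- `p` is a path: a sequence of at least two distinct nodes in which every pair of
successive nodes is adjacent. -/
def IsPath (G : PDG V) (p : List V) : Prop :=
  2 ≤ p.length ∧ p.Nodup ∧ p.Chain' G.Adj

/-- `p` is a path from `a` to `b`. -/
def IsPathFrom (G : PDG V) (p : List V) (a b : V) : Prop :=
  G.IsPath p ∧ p.head? = some a ∧ p.getLast? = some b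

/-- `p` is a possibly causal path: no edge `V_i ← V_j` with `i < j` is in `G`. -/
def PossiblyCausal (G : PDG V) (p : List V) : Prop :=
  G.IsPath p ∧ ∀ i j : Fin p.length, (i : ℕ) < (j : ℕ) → ¬ G.dir (p.get j) (p.get i)

/-- `p` is a causal path: all edges directed towards the endpoint. -/
def IsCausal (G : PDG V) (p : List V) : Prop :=
  2 ≤ p.length ∧ p.Nodup ∧ p.Chain' G.dir

/-- `p` is an undirected path. -/
def IsUndirPath (G : PDG V) (p : List V) : Prop :=
  p ≠ [] ∧ p.Nodup ∧ p.Chain' G.undir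

/-- `p` is unshielded: every two nodes at distance two on `p` are nonadjacent. -/
def Unshielded (G : PDG V) (p : List V) : Prop :=
  ∀ (i : ℕ) (h : i + 2 < p.length),
    ¬ G.Adj (p.get ⟨i, by omega⟩) (p.get ⟨i + 2, h⟩)

/-- `p` is proper w.r.t. the node set `X` : only its first node is in `X`. -/
def ProperFrom (X : Finset V) (p : List V) : Prop :=
  (∃ a ∈ X, p.head? = some a) ∧ ∀ i : Fin p.length, 0 < (i : ℕ) → p.get i ∉ X

/-- the last node of `p` is in `Y`. -/
def EndsIn (Y : Finset V) (p : List V) : Prop := ∃ b ∈ Y, p.getLast? = some b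

/-- `p` starts with an undirected edge. -/
def StartsUndirected (G : PDG V) (p : List V) : Prop :=
  ∃ a b l, p = a :: b :: l ∧ G.undir a b

/-- There is no proper possibly causal path from `X` to `Y` in `G` that starts with
an undirected edge. -/
def NoProperPCUndirStart (G : PDG V) (X Y : Finset V) : Prop :=
  ¬ ∃ p, G.PossiblyCausal p ∧ ProperFrom X p ∧ EndsIn Y p ∧ G.StartsUndirected p

/-- `A` is an undirected connected node set in `G`: every two distinct nodes of `A`
are joined by an undirected path in `G`. -/
def UndirConnected (G : PDG V) (A : Finset V) : Prop :=
  ∀ a ∈ A, ∀ b ∈ A, a ≠ b →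
    ∃ p, G.IsUndirPath p ∧ p.head? = some a ∧ p.getLast? = some b

/-- `B` is a bucket in `D`: a maximal undirected connected subset of `D` in `G`. -/
def Bucket (G : PDG V) (B D : Finset V) : Prop :=
  B.Nonempty ∧ B ⊆ D ∧ G.UndirConnected B ∧
    ∀ B' : Finset V, B ⊆ B' → B' ⊆ D → G.UndirConnected B' → B' = B

section DecEq

variable [DecidableEq V]

/-- `Bs` lists the bucket decomposition of `D`: the listed sets are buckets in `D`,
pairwise disjoint, with union `D`. -/
def IsBucketDecompList (G : PDG V) (D : Finset V) (Bs : List (Finset V)) : Prop :=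
  (∀ B ∈ Bs, G.Bucket B D) ∧ (Bs.Pairwise fun B B' => Disjoint B B') ∧
    Bs.foldr (· ∪ ·) ∅ = D

end DecEq

/-- The listed node sets are totally ordered as a partial causal ordering in `G` :
every edge between an earlier set and a later one points towards the later one. -/
def OrderedDecomp (G : PDG V) (Bs : List (Finset V)) : Prop :=
  ∀ i j : Fin Bs.length, (i : ℕ) < (j : ℕ) →
    ∀ a ∈ Bs.get i, ∀ b ∈ Bs.get j, G.Adj a b → G.dir a b

/-- the node at (interior) position `i` of `p` is a collider on `p`. -/
def ColliderAt (G : PDG V) (p : List V) (i : ℕ) : Prop :=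
  ∃ u v w, p[i-1]? = some u ∧ p[i]? = some v ∧ p[i+1]? = some w ∧
    1 ≤ i ∧ G.dir u v ∧ G.dir w v

/-- the node at (interior) position `i` of `p` is a definite non-collider on `p`. -/
def DefNonColliderAt (G : PDG V) (p : List V) (i : ℕ) : Prop :=
  ∃ u v w, p[i-1]? = some u ∧ p[i]? = some v ∧ p[i+1]? = some w ∧ 1 ≤ i ∧
    (G.dir v u ∨ G.dir v w ∨ (G.undir u v ∧ G.undir v w ∧ ¬ G.Adj u w))

/-- `p` is a definite status path: every interior node is a collider or a definite
non-collider on `p`. -/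
def DefiniteStatus (G : PDG V) (p : List V) : Prop :=
  ∀ i : ℕ, 1 ≤ i → i + 1 < p.length → G.ColliderAt p i ∨ G.DefNonColliderAt p i

/-- `p` is d-connecting given `Z` (in a DAG): every non-collider on `p` is outside
`Z` and every collider on `p` has a descendant in `Z`. -/
def DConnGiven (G : PDG V) (Z : Finset V) (p : List V) : Prop :=
  (∀ i u, 1 ≤ i → i + 1 < p.length → p[i]? = some u → ¬ G.ColliderAt p i → u ∉ Z) ∧
  (∀ i u, G.ColliderAt p i → p[i]? = some u →
    ∃ z ∈ Z, Relation.ReflTransGen G.dir u z)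

/-- `A` and `B` are d-separated given `Z` : no path between them is d-connecting
given `Z`. -/
def DSep (G : PDG V) (A B Z : Finset V) : Prop :=
  ∀ p a b, a ∈ A → b ∈ B → G.IsPathFrom p a b → ¬ G.DConnGiven Z p

/-- `p` is d-connecting given `Z` (definite status version): every definite
non-collider on `p` is outside `Z` and every collider on `p` has a descendant in `Z`. -/
def DConnDS (G : PDG V) (Z : Finset V) (p : List V) : Prop :=
  (∀ i u, G.DefNonColliderAt p i → p[i]? = some u → u ∉ Z) ∧
  (∀ i u, G.ColliderAt p i → p[i]? = some u →
    ∃ z ∈ Z, Relation.ReflTransGen G.dir u z)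

/-- `Z` blocks the (definite status) path `p`. -/
def Blocks (G : PDG V) (Z : Finset V) (p : List V) : Prop := ¬ G.DConnDS Z p

/-- `D_{X̄}` : remove all edges into `X`. -/
def removeInto (D : PDG V) (X : Finset V) : PDG V where
  dir a b := D.dir a b ∧ b ∉ X
  undir := D.undir
  undir_symm := D.undir_symm
  dir_irrefl := fun a h => D.dir_irrefl a h.1
  undir_irrefl := D.undir_irrefl
  dir_asymm := fun a b h h' => D.dir_asymm a b h.1 h'.1
  dir_not_undir := fun a b h => D.dir_not_undir a b h.1

/-- `D_{X̲}` : remove all edges out of `X`. -/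
def removeOutOf (D : PDG V) (X : Finset V) : PDG V where
  dir a b := D.dir a b ∧ a ∉ X
  undir := D.undir
  undir_symm := D.undir_symm
  dir_irrefl := fun a h => D.dir_irrefl a h.1
  undir_irrefl := D.undir_irrefl
  dir_asymm := fun a b h h' => D.dir_asymm a b h.1 h'.1
  dir_not_undir := fun a b h => D.dir_not_undir a b h.1

/-- `w'` is a possible descendant of `w` in `G`. -/
def PossibleDesc (G : PDG V) (w w' : V) : Prop :=
  w = w' ∨ ∃ p, G.PossiblyCausal p ∧ p.head? = some w ∧ p.getLast? = some w'

section Fin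

variable [Fintype V] [DecidableEq V]

/-- the parents of the node `v` in `G`. -/
def paFin (G : PDG V) (v : V) : Finset V := Finset.univ.filter fun u => G.dir u v

/-- `Pa(S, G)` : the parents of the node set `S` in `G`, excluding `S` itself. -/
def PaFin (G : PDG V) (S : Finset V) : Finset V :=
  (Finset.univ.filter fun u => ∃ v ∈ S, G.dir u v) \ S

/-- `a` is an ancestor of `y` within the induced subgraph of `G` on `S`
(every node is an ancestor of itself). -/
def AncestorIn (G : PDG V) (S : Finset V) (a y : V) : Prop :=
  a ∈ S ∧ y ∈ S ∧ Relation.ReflTransGen (fun u v => G.dir u v ∧ u ∈ S ∧ v ∈ S) a y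

/-- `An(Y, G_S)` : the ancestors of `Y` in the induced subgraph of `G` on `S`. -/
def AnIn (G : PDG V) (Y S : Finset V) : Finset V :=
  Finset.univ.filter fun a => ∃ y ∈ Y, G.AncestorIn S a y

/-- `forb(X, Y, G)` for single nodes `X`, `Y` : all possible descendants of nodes
`W ≠ X` lying on a proper possibly causal path from `X` to `Y` in `G`. -/
def Forb (G : PDG V) (X Y : V) : Finset V :=
  Finset.univ.filter fun w' => ∃ w, w ≠ X ∧
    (∃ p, G.PossiblyCausal p ∧ p.head? = some X ∧ p.getLast? = some Y ∧ w ∈ p) ∧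
    G.PossibleDesc w w'

end Fin

end PDG

section Density

open PDG

variable {V : Type} [Fintype V] [DecidableEq V] {Ω : Type} [Fintype Ω] [DecidableEq Ω]

/-- the marginal of `f` over the node set `S`, at the values given by `g`. -/
def margin (f : (V → Ω) → ℝ) (S : Finset V) (g : V → Ω) : ℝ :=
  ∑ h : V → Ω, if ∀ v ∈ S, h v = g v then f h else 0

/-- the conditional density `f(a | b)` of `A` given `B`, at the values given by `g`. -/
def condOn (f : (V → Ω) → ℝ) (A B : Finset V) (g : V → Ω) : ℝ :=
  margin f (A ∪ B) g / margin f B g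

/-- `f` is a strictly positive discrete density over `V`. -/
def IsPosDensity (f : (V → Ω) → ℝ) : Prop :=
  (∀ g, 0 < f g) ∧ ∑ g : V → Ω, f g = 1

/-- `f` is consistent with the DAG `D` : it factorizes according to `D`. -/
def ConsistentWith (f : (V → Ω) → ℝ) (D : PDG V) : Prop :=
  ∀ g, f g = ∏ v : V, condOn f {v} (D.paFin v) g

/-- the interventional density obtained from `f` by truncated factorization with
respect to the DAG `D` under `do(X = x)`, evaluated at `g` (parent values in `X`
are taken in agreement with `x`). -/
def doDens (f : (V → Ω) → ℝ) (D : PDG V) (X : Finset V) (x : V → Ω) (g : V → Ω) : ℝ :=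
  ∏ v ∈ Finset.univ \ X, condOn f {v} (D.paFin v) fun u => if u ∈ X then x u else g u

/-- `f(y | do(x))` : the marginal over `Y` of the interventional density obtained
from `f` by truncated factorization with respect to `D`. -/
def doMargin (f : (V → Ω) → ℝ) (D : PDG V) (X : Finset V) (x : V → Ω)
    (Y : Finset V) (y : V → Ω) : ℝ :=
  ∑ g : V → Ω,
    if (∀ v ∈ X, g v = x v) ∧ (∀ v ∈ Y, g v = y v) then doDens f D X x g else 0

end Density

open PDG

open Relation

theorem exists_walk_of_reflTransGen {α : Type*} {R : α → α → Prop} {a b : α}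
    (h : ReflTransGen R a b) :
    ∃ (n : ℕ) (f : ℕ → α), f 0 = a ∧ f n = b ∧ ∀ i < n, R (f i) (f (i + 1)) := by
  induction h using ReflTransGen.head_induction_on with
  | refl => exact ⟨0, fun _ => b, rfl, rfl, by simp⟩
  | @head u v huv _ ih =>
    obtain ⟨n, f, h0, hn, hs⟩ := ih
    refine ⟨n + 1, fun k => Nat.casesOn k u f, rfl, hn, ?_⟩
    rintro (_ | i) hi
    · simpa [h0] using huv
    · exact hs i (by omega)

theorem exists_shortest_walk {α : Type*} {R : α → α → Prop} (S T : α → Prop) {a b : α}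
    (ha : S a) (hb : T b) (h : ReflTransGen R a b) :
    ∃ (n : ℕ) (f : ℕ → α), S (f 0) ∧ T (f n) ∧ (∀ i < n, R (f i) (f (i + 1))) ∧
      (∀ i j, i < j → j ≤ n → f i ≠ f j) ∧ (∀ i j, i + 1 < j → j ≤ n → ¬ R (f i) (f j)) ∧
      (∀ j, 0 < j → j ≤ n → ¬ S (f j)) ∧ ∀ i < n, ¬ T (f i) := by
  have hex : ∃ n, ∃ f : ℕ → α, S (f 0) ∧ T (f n) ∧ ∀ i < n, R (f i) (f (i + 1)) := by
    obtain ⟨n, f, h0, hn, hs⟩ := exists_walk_of_reflTransGen h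
    exact ⟨n, f, h0 ▸ ha, hn ▸ hb, hs⟩
  obtain ⟨f, h0, hn, hs⟩ := Nat.find_spec hex
  have hmin := fun m => @Nat.find_min _ _ hex m
  generalize Nat.find hex = n at *
  have hT : ∀ i < n, ¬ T (f i) := fun i hi ht =>
    hmin i hi ⟨f, h0, ht, fun k hk => hs k (by omega)⟩
  have hR : ∀ i j, i + 1 < j → j ≤ n → ¬ R (f i) (f j) := by
    intro i j hij hj hr
    refine hmin (n - (j - i - 1)) (by omega)
      ⟨fun k => if k ≤ i then f k else f (k + (j - i - 1)), by simpa using h0, ?_, ?_⟩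
    · dsimp only
      rw [if_neg (by omega), show n - (j - i - 1) + (j - i - 1) = n by omega]
      exact hn
    · intro k hk
      dsimp only
      rcases lt_trichotomy k i with h | rfl | h
      · rw [if_pos (by omega), if_pos (by omega)]
        exact hs k (by omega)
      · rw [if_pos le_rfl, if_neg (by omega), show k + 1 + (j - k - 1) = j by omega]
        exact hr
      · rw [if_neg (by omega), if_neg (by omega),
          show k + 1 + (j - i - 1) = k + (j - i - 1) + 1 by omega]
        exact hs _ (by omega)
  refine ⟨n, f, h0, hn, hs, ?_, hR, ?_, hT⟩
  · intro i j hij hj he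
    rcases hj.lt_or_eq with hlt | rfl
    · exact hR i (j + 1) (by omega) (by omega) (he ▸ hs j hlt)
    · exact hT i hij (he ▸ hn)
  · intro j hj0 hj hSj
    refine hmin (n - j) (by omega) ⟨fun k => f (k + j), by simpa using hSj, ?_, ?_⟩
    · simpa [Nat.sub_add_cancel hj] using hn
    · intro k hk
      dsimp only
      rw [show k + 1 + j = k + j + 1 by omega]
      exact hs _ (by omega)

theorem reflTransGen_of_walk {α : Type*} {R : α → α → Prop} {f : ℕ → α} {i j : ℕ} (hij : i ≤ j)
    (h : ∀ m, i ≤ m → m < j → R (f m) (f (m + 1))) : ReflTransGen R (f i) (f j) := by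
  induction j, hij using Nat.le_induction with
  | base => exact .refl
  | succ j hij ih => exact (ih fun m hm hm' => h m hm (by omega)).tail (h j hij (by omega))

namespace PDG

/-- A step along a directed or undirected edge inside `T`. -/
def SemiStep {V : Type} (G : PDG V) (T : V → Prop) (u v : V) : Prop :=
  (G.dir u v ∨ G.undir u v) ∧ T u ∧ T v

/-- A step along an undirected edge inside `T`. -/
def UndirStep {V : Type} (G : PDG V) (T : V → Prop) (u v : V) : Prop :=
  G.undir u v ∧ T u ∧ T v

variable {V : Type} {G D : PDG V} {X Y : Finset V}

theorem Adj.symm {a b : V} (h : G.Adj a b) : G.Adj b a := by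
  rcases h with h | h | h
  · exact Or.inr (Or.inl h)
  · exact Or.inl h
  · exact Or.inr (Or.inr (G.undir_symm _ _ h))

theorem UndirStep.symm {T : V → Prop} {a b : V} (h : G.UndirStep T a b) : G.UndirStep T b a :=
  ⟨G.undir_symm _ _ h.1, h.2.2, h.2.1⟩

theorem UndirStep.semiStep {T : V → Prop} {a b : V} (h : G.UndirStep T a b) :
    G.SemiStep T a b := ⟨Or.inr h.1, h.2⟩

theorem reflTransGen_undirStep_symm {T : V → Prop} {a b : V}
    (h : ReflTransGen (G.UndirStep T) a b) : ReflTransGen (G.UndirStep T) b a :=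
  have : Std.Symm (G.UndirStep T) := ⟨fun _ _ => UndirStep.symm⟩
  ReflTransGen.stdSymm.symm _ _ h

theorem reflTransGen_undirStep_mem {T : V → Prop} {a b : V}
    (h : ReflTransGen (G.UndirStep T) a b) (ha : T a) : T b := by
  induction h with
  | refl => exact ha
  | tail _ h _ => exact h.2.2

theorem exists_possiblyCausal {x : V} {n : ℕ} {f : ℕ → V}
    (hx : x ∈ X) (h0 : G.undir x (f 0)) (hfX : ∀ i ≤ n, f i ∉ X) (hn : f n ∈ Y)
    (hs : ∀ i < n, G.Adj (f i) (f (i + 1))) (hinj : ∀ i j, i < j → j ≤ n → f i ≠ f j)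
    (hback : ∀ i j, i < j → j ≤ n → ¬ G.dir (f j) (f i)) (hbx : ∀ j ≤ n, ¬ G.dir (f j) x) :
    ∃ p, G.PossiblyCausal p ∧ ProperFrom X p ∧ EndsIn Y p ∧ G.StartsUndirected p := by
  let g : ℕ → V := fun k => Nat.casesOn k x f
  have hgX : ∀ i, 0 < i → i < n + 2 → g i ∉ X := by
    rintro (_ | i) hi hi'
    · omega
    · exact hfX i (by omega)
  have hgs : ∀ i, i + 1 < n + 2 → G.Adj (g i) (g (i + 1)) := by
    rintro (_ | i) hi
    · exact Or.inr (Or.inr h0)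
    · exact hs i (by omega)
  have hgb : ∀ i j, i < j → j < n + 2 → ¬ G.dir (g j) (g i) := by
    rintro (_ | i) (_ | j) hij hj
    · omega
    · exact hbx j (by omega)
    · omega
    · exact hback i j (by omega) (by omega)
  have hgi : ∀ i j, i < j → j < n + 2 → g i ≠ g j := by
    rintro (_ | i) (_ | j) hij hj
    · omega
    · exact fun h : x = f j => hfX j (by omega) (h ▸ hx)
    · omega
    · exact hinj i j (by omega) (by omega)
  refine ⟨List.ofFn fun i : Fin (n + 2) => g i, ⟨⟨by simp, ?_, ?_⟩, ?_⟩, ⟨⟨x, hx, ?_⟩, ?_⟩,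
    ⟨f n, hn, ?_⟩, x, f 0, List.ofFn fun i : Fin n => f (i + 1), ?_, h0⟩
  · rw [List.nodup_ofFn]
    intro i j h
    rcases lt_trichotomy i j with hij | hij | hij
    · exact absurd h (hgi i j hij j.2)
    · exact hij
    · exact absurd h.symm (hgi j i hij i.2)
  · show List.IsChain _ _
    rw [List.isChain_iff_getElem]
    intro i hi
    rw [List.length_ofFn] at hi
    simpa [-List.ofFn_succ] using hgs i hi
  · intro i j hij
    simpa [-List.ofFn_succ] using hgb i j hij (j.2.trans_eq List.length_ofFn)
  · simp [List.ofFn_succ, g]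
  · intro i hi
    simpa [-List.ofFn_succ] using hgX i hi (i.2.trans_eq List.length_ofFn)
  · simp [List.getLast?_eq_getElem?, -List.ofFn_succ, g]
  · simp [List.ofFn_succ, g]

theorem IsMPDAG.false_of_semiWalk (hG : G.IsMPDAG) (hno : G.NoProperPCUndirStart X Y)
    {x c y : V} {T : V → Prop} (hx : x ∈ X) (hT : ∀ t, T t → t ∉ X) (hc : T c)
    (hxc : G.undir x c) (hy : y ∈ Y) (hwalk : ReflTransGen (G.SemiStep T) c y)
    (hin : ∀ s, ReflTransGen (G.UndirStep T) c s → ¬ G.dir s x) : False := by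
  obtain ⟨n, f, ⟨hc0, hx0⟩, hn, hs, hinj, hch, hSf, -⟩ :=
    exists_shortest_walk (fun w => ReflTransGen (G.UndirStep T) c w ∧ G.undir x w) (· ∈ Y)
      ⟨.refl, hxc⟩ hy hwalk
  have hfT : ∀ i ≤ n, T (f i) := by
    rintro (_ | i) hi
    · exact reflTransGen_undirStep_mem hc0 hc
    · exact (hs i hi).2.2
  have hchord : ∀ i j, i + 1 < j → j ≤ n → G.Adj (f i) (f j) → G.dir (f j) (f i) := by
    rintro i j hij hj (h | h | h)
    · exact absurd ⟨Or.inl h, hfT i (by omega), hfT j hj⟩ (hch i j hij hj)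
    · exact h
    · exact absurd ⟨Or.inr h, hfT i (by omega), hfT j hj⟩ (hch i j hij hj)
  have hdir : ∀ i j, i < j → j < n → G.dir (f i) (f (i + 1)) → G.dir (f j) (f (j + 1)) := by
    intro i j hij
    induction j, hij using Nat.le_induction with
    | base =>
      intro hj h
      refine (hs (i + 1) hj).1.resolve_right fun hu => ?_
      have := hchord i (i + 2) (by omega) hj (hG.meek1 _ _ _ h hu)
      exact hG.meek2 _ _ _ this h (G.undir_symm _ _ hu)
    | succ j hij ih =>
      intro hj h
      refine (hs (j + 1) hj).1.resolve_right fun hu => ?_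
      have hd := ih (by omega) h
      have := hchord j (j + 2) (by omega) hj (hG.meek1 _ _ _ hd hu)
      exact hG.meek2 _ _ _ this hd (G.undir_symm _ _ hu)
  have htrans : ∀ i j, i < j → j ≤ n → G.dir (f i) (f (i + 1)) →
      TransGen G.dir (f i) (f j) := by
    intro i j hij
    induction j, hij using Nat.le_induction with
    | base => exact fun _ h => .single h
    | succ j hij ih => exact fun hj h => (ih (by omega) h).tail (hdir i j hij hj h)
  have hundir : ∀ i j, i < j → j ≤ n → G.dir (f j) (f i) →
      ∀ m < i + 1, G.undir (f m) (f (m + 1)) := by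
    intro i j hij hj h m hm
    refine (hs m (by omega)).1.resolve_left fun hd => ?_
    have hi : G.dir (f i) (f (i + 1)) := by
      rcases Nat.lt_succ_iff_lt_or_eq.1 hm with hm | rfl
      · exact hdir m i hm (by omega) hd
      · exact hd
    exact hG.acyclic _ ((htrans i j hij hj hi).tail h)
  have hup : ∀ k i j, j = i + k + 1 → j ≤ n → G.dir (f j) (f i) →
      ∀ m < j, G.undir (f m) (f (m + 1)) := by
    intro k
    induction k with
    | zero =>
      rintro i j rfl hj h m hm
      exact hundir i (i + 1) (by omega) hj h m hm
    | succ k ih =>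
      rintro i j rfl hj h
      have hu := hundir i _ (by omega) hj h i (by omega)
      rcases hG.meek1 _ _ _ h hu with h' | h' | h'
      · exact ih (i + 1) _ (by omega) hj h'
      · exact absurd (G.undir_symm _ _ hu) (hG.meek2 _ _ _ h' h)
      · have hk : k = 0 := by
          by_contra hk
          exact hch (i + 1) _ (by omega) hj
            ⟨Or.inr (G.undir_symm _ _ h'), hfT _ (by omega), hfT _ hj⟩
        subst hk
        intro m hm
        rcases Nat.lt_succ_iff_lt_or_eq.1 hm with hm | rfl
        · exact hundir i _ (by omega) hj h m hm
        · exact G.undir_symm _ _ h'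
  have hdown : ∀ i j, i < j → j ≤ n → G.dir (f j) (f i) → G.dir (f j) (f 0) := by
    intro i
    induction i with
    | zero => exact fun _ _ _ h => h
    | succ i ih =>
      intro j hij hj h
      have hu := hundir _ j hij hj h i (by omega)
      exact ih j (by omega) hj (hchord i j hij hj
        (hG.meek1 _ _ _ h (G.undir_symm _ _ hu)).symm)
  have hreach : ∀ j ≤ n, (∀ m < j, G.undir (f m) (f (m + 1))) →
      ReflTransGen (G.UndirStep T) c (f j) := by
    intro j
    induction j with
    | zero => exact fun _ _ => hc0
    | succ j ih =>
      exact fun hj h => (ih (by omega) fun m hm => h m (by omega)).tail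
        ⟨h j (by omega), hfT j (by omega), hfT _ hj⟩
  have hback : ∀ i j, i < j → j ≤ n → ¬ G.dir (f j) (f i) := by
    intro i j hij hj h
    have hr := hreach j hj (hup (j - i - 1) i j (by omega) hj h)
    have h0 := hdown i j hij hj h
    rcases hG.meek1 _ _ _ h0 (G.undir_symm _ _ hx0) with h' | h' | h'
    · exact hin _ hr h'
    · exact hG.meek2 _ _ _ h' h0 hx0
    · exact hSf j (by omega) hj ⟨hr, G.undir_symm _ _ h'⟩
  refine hno (exists_possiblyCausal hx hx0 (fun i hi => hT _ (hfT i hi)) hn ?_ hinj hback ?_)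
  · exact fun i hi => (hs i hi).1.elim Or.inl fun h => Or.inr (Or.inr h)
  · intro j hj h
    rcases j with _ | _ | j
    · exact G.dir_not_undir _ _ h (G.undir_symm _ _ hx0)
    · rcases (hs 0 hj).1 with h' | h'
      · exact hG.meek2 _ _ _ h' h (G.undir_symm _ _ hx0)
      · exact hin _ (hc0.tail ⟨h', hfT 0 (by omega), hfT 1 hj⟩) h
    · exact hback 0 (j + 2) (by omega) hj
        (hchord 0 (j + 2) (by omega) hj (hG.meek1 _ _ _ h hx0).symm)

/-- `a` has a causal walk to `Y` avoiding `X`. -/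
def AncAvoiding (G : PDG V) (X Y : Finset V) (a : V) : Prop :=
  a ∉ X ∧ ∃ y ∈ Y, ReflTransGen (fun u v => G.dir u v ∧ u ∉ X ∧ v ∉ X) a y

theorem reflTransGen_semiStep_of_dir {T : V → Prop} {a y : V}
    (h : ReflTransGen (fun u v => G.dir u v ∧ u ∉ X ∧ v ∉ X) a y)
    (hT : ∀ v, v ∉ X → ReflTransGen G.dir a v → T v) : ReflTransGen (G.SemiStep T) a y := by
  have key : ReflTransGen G.dir a y ∧ ReflTransGen (G.SemiStep T) a y := by
    induction h with
    | refl => exact ⟨.refl, .refl⟩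
    | tail _ h ih =>
      exact ⟨ih.1.tail h.1, ih.2.tail ⟨.inl h.1, hT _ h.2.1 ih.1, hT _ h.2.2 (ih.1.tail h.1)⟩⟩
  exact key.2

theorem IsMPDAG.false_of_semiWalk_of_not_dir (hG : G.IsMPDAG)
    (hno : G.NoProperPCUndirStart X Y) {x c y : V} (hx : x ∈ X) (hc : c ∉ X)
    (hxc : G.undir x c) (hy : y ∈ Y)
    (hwalk : ReflTransGen (G.SemiStep fun t => t ∉ X ∧ ¬ G.dir t x) c y) : False := by
  have hcT : c ∉ X ∧ ¬ G.dir c x :=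
    ⟨hc, fun h => G.dir_not_undir _ _ h (G.undir_symm _ _ hxc)⟩
  exact hG.false_of_semiWalk hno (T := fun t => t ∉ X ∧ ¬ G.dir t x) hx (fun _ h => h.1) hcT
    hxc hy hwalk fun s hs => (reflTransGen_undirStep_mem hs hcT).2

theorem IsMPDAG.exists_dir_of_undir (hG : G.IsMPDAG) (hno : G.NoProperPCUndirStart X Y)
    {x a c : V} (hx : x ∈ X) (ha : G.AncAvoiding X Y a)
    (hac : ReflTransGen (G.UndirStep (· ∉ X)) a c) (hxc : G.undir x c) :
    ∃ s, ReflTransGen (G.UndirStep (· ∉ X)) a s ∧ G.dir s x := by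
  by_contra! hcon
  obtain ⟨haX, y, hy, hay⟩ := ha
  refine hG.false_of_semiWalk hno (T := (· ∉ X)) hx (fun _ h => h)
    (reflTransGen_undirStep_mem (T := (· ∉ X)) hac haX) hxc hy ?_ fun s hs => hcon s (hac.trans hs)
  exact (ReflTransGen.mono (fun _ _ => UndirStep.semiStep) _ _ (reflTransGen_undirStep_symm hac)).trans
    (reflTransGen_semiStep_of_dir hay fun v hv _ => hv)

theorem IsMPDAG.mem_or_exists_dir_of_reflTransGen_undir (hG : G.IsMPDAG)
    (hno : G.NoProperPCUndirStart X Y) {a v : V} (ha : G.AncAvoiding X Y a)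
    (hav : ReflTransGen G.undir a v) :
    ReflTransGen (G.UndirStep (· ∉ X)) a v ∨
      ∃ s, ReflTransGen (G.UndirStep (· ∉ X)) a s ∧ G.dir s v := by
  induction hav with
  | refl => exact .inl .refl
  | @tail v w _ hvw ih =>
    have step : ∀ u, ReflTransGen (G.UndirStep (· ∉ X)) a u → G.undir u w →
        ReflTransGen (G.UndirStep (· ∉ X)) a w ∨
          ∃ s, ReflTransGen (G.UndirStep (· ∉ X)) a s ∧ G.dir s w := by
      intro u hu huw
      by_cases hw : w ∈ X
      · exact .inr (hG.exists_dir_of_undir hno hw ha hu (G.undir_symm _ _ huw))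
      · exact .inl (hu.tail ⟨huw, reflTransGen_undirStep_mem (T := (· ∉ X)) hu ha.1, hw⟩)
    rcases ih with h | ⟨s, hs, hsv⟩
    · exact step v h hvw
    · rcases hG.meek1 _ _ _ hsv hvw with h | h | h
      · exact .inr ⟨s, hs, h⟩
      · exact absurd (G.undir_symm _ _ hvw) (hG.meek2 _ _ _ h hsv)
      · exact step s hs h

theorem IsMPDAG.dir_of_reflTransGen_undirStep (hG : G.IsMPDAG) {T : V → Prop} {q u w : V}
    (hqu : G.dir q u) (hq : ∀ w, ReflTransGen (G.UndirStep T) u w → ¬ G.undir q w)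
    (huw : ReflTransGen (G.UndirStep T) u w) : G.dir q w := by
  induction huw with
  | refl => exact hqu
  | tail huv hvw ih =>
    rcases hG.meek1 _ _ _ ih hvw.1 with h | h | h
    · exact h
    · exact absurd (G.undir_symm _ _ hvw.1) (hG.meek2 _ _ _ h ih)
    · exact absurd h (hq _ (huv.tail hvw))

theorem IsMPDAG.reflTransGen_undirStep_of_ancAvoiding (hG : G.IsMPDAG)
    (hno : G.NoProperPCUndirStart X Y) {a b : V} (ha : G.AncAvoiding X Y a)
    (hb : G.AncAvoiding X Y b) (hab : ReflTransGen G.undir a b) :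
    ReflTransGen (G.UndirStep (· ∉ X)) a b := by
  by_contra hcon
  have hba : ReflTransGen G.undir b a :=
    have : Std.Symm G.undir := ⟨G.undir_symm⟩
    ReflTransGen.stdSymm.symm _ _ hab
  obtain ⟨s, hs, hsb⟩ := (hG.mem_or_exists_dir_of_reflTransGen_undir hno ha hab).resolve_left hcon
  obtain ⟨t, ht, hta⟩ := (hG.mem_or_exists_dir_of_reflTransGen_undir hno hb hba).resolve_left
    fun h => hcon (reflTransGen_undirStep_symm h)
  have hne : ∀ u w, ReflTransGen (G.UndirStep (· ∉ X)) a u →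
      ReflTransGen (G.UndirStep (· ∉ X)) b w → ¬ G.undir u w := fun u w hu hw h =>
    hcon ((hu.tail ⟨h, reflTransGen_undirStep_mem (T := (· ∉ X)) hu ha.1,
      reflTransGen_undirStep_mem (T := (· ∉ X)) hw hb.1⟩).trans (reflTransGen_undirStep_symm hw))
  have hst := hG.dir_of_reflTransGen_undirStep hsb (fun w hw => hne s w hs hw) ht
  have hts := hG.dir_of_reflTransGen_undirStep hta
    (fun w hw h => hne w t hw ht (G.undir_symm _ _ h)) hs
  exact G.dir_asymm _ _ hst hts

theorem IsMPDAG.dir_of_dir_ancAvoiding (hG : G.IsMPDAG)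
    (hno : G.NoProperPCUndirStart X Y) {x b c : V} (hx : x ∈ X) (hb : G.AncAvoiding X Y b)
    (hxb : G.dir x b) (hbc : ReflTransGen (G.UndirStep (· ∉ X)) b c) : G.dir x c := by
  obtain ⟨hbX, y, hy, hby⟩ := hb
  have key : G.dir x c ∧ ReflTransGen (G.SemiStep fun t => t ∉ X ∧ ¬ G.dir t x) c y := by
    induction hbc with
    | refl =>
      exact ⟨hxb, reflTransGen_semiStep_of_dir hby fun v hv hbv =>
        ⟨hv, fun h => hG.acyclic x (TransGen.tail (TransGen.head' hxb hbv) h)⟩⟩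
    | @tail u w _ huw ih =>
      have hu : u ∉ X ∧ ¬ G.dir u x := ⟨huw.2.1, G.dir_asymm _ _ ih.1⟩
      have hstep : ¬ G.dir w x → ReflTransGen (G.SemiStep fun t => t ∉ X ∧ ¬ G.dir t x) w y :=
        fun h => ih.2.head ⟨.inr (G.undir_symm _ _ huw.1), ⟨huw.2.2, h⟩, hu⟩
      rcases hG.meek1 _ _ _ ih.1 huw.1 with h | h | h
      · exact ⟨h, hstep (G.dir_asymm _ _ h)⟩
      · exact absurd (G.undir_symm _ _ huw.1) (hG.meek2 _ _ _ h ih.1)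
      · exact (hG.false_of_semiWalk_of_not_dir hno hx huw.2.2 h hy
          (hstep fun h' => G.dir_not_undir _ _ h' (G.undir_symm _ _ h))).elim
  exact key.1

/-- A directed walk to `B` in a represented DAG that avoids the parents of `B` stays within
the undirected components of `B` outside `X`. -/
theorem IsMPDAG.exists_reflTransGen_undirStep (hG : G.IsMPDAG)
    (hno : G.NoProperPCUndirStart X Y) (hD : D.InClassOf G) {B Q : V → Prop}
    (hB : ∀ b, B b → G.AncAvoiding X Y b) (hQ : ∀ q b, B b → G.dir q b → ¬ B q → Q q)
    {u b : V} (hb : B b) (hub : ReflTransGen (fun s t => D.dir s t ∧ ¬ Q s) u b) :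
    ∃ b', B b' ∧ ReflTransGen (G.UndirStep (· ∉ X)) u b' := by
  obtain ⟨⟨hDu, hDa⟩, hadj, -, hsub⟩ := hD
  obtain ⟨n, f, rfl, hn, hs, hinj, hch, -, hfB⟩ := exists_shortest_walk (· = u) B rfl hb hub
  have hDtrans : ∀ i j, i < j → j ≤ n → TransGen D.dir (f i) (f j) := by
    intro i j hij
    induction j, hij using Nat.le_induction with
    | base => exact fun h => .single (hs i h).1
    | succ j hij ih => exact fun h => (ih (by omega)).tail (hs j h).1
  have hG2 : ∀ i < n, G.dir (f i) (f (i + 1)) ∨ G.undir (f i) (f (i + 1)) := by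
    intro i hi
    rcases (hadj _ _).2 (.inl (hs i hi).1) with h | h | h
    · exact .inl h
    · exact absurd (hsub _ _ h) (D.dir_asymm _ _ (hs i hi).1)
    · exact .inr h
  have hun : ∀ i, i + 2 ≤ n → ¬ G.Adj (f i) (f (i + 2)) := by
    intro i hi h
    rcases (hadj _ _).1 h with h | h | h
    · exact hch i (i + 2) (by omega) hi ⟨h, (hs i (by omega)).2⟩
    · exact hDa _ ((hDtrans i (i + 2) (by omega) hi).tail h)
    · exact hDu _ _ h
  have hundir : ∀ k i, i + k + 1 = n → G.undir (f i) (f (i + 1)) := by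
    intro k
    induction k with
    | zero =>
      rintro i rfl
      refine (hG2 i (by omega)).resolve_left fun h => ?_
      exact (hs i (by omega)).2 (hQ _ _ hn h (hfB i (by omega)))
    | succ k ih =>
      rintro i rfl
      refine (hG2 i (by omega)).resolve_left fun h => ?_
      exact hun i (by omega) (hG.meek1 _ _ _ h (ih (i + 1) (by omega)))
  have hX' : ∀ k i, i + k = n → ∀ m, i ≤ m → m ≤ n → f m ∉ X := by
    intro k
    induction k with
    | zero =>
      intro i hi m him hm
      obtain rfl : m = n := by omega
      exact (hB _ hn).1
    | succ k ih =>
      intro i hi m him hm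
      rcases him.lt_or_eq with him | rfl
      · exact ih (i + 1) (by omega) m him hm
      intro hx
      obtain ⟨-, y, hy, hby⟩ := hB _ hn
      have hT : ∀ m, i < m → m ≤ n → f m ∉ X ∧ ¬ G.dir (f m) (f i) := fun m him hm =>
        ⟨ih (i + 1) (by omega) m him hm, fun h => hDa _ ((hDtrans i m him hm).tail (hsub _ _ h))⟩
      refine hG.false_of_semiWalk_of_not_dir hno hx (hT (i + 1) (by omega) (by omega)).1
        (hundir k i (by omega)) hy ?_
      refine (reflTransGen_of_walk (f := f) (j := n) (by omega) fun m h h' =>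
        ⟨hG2 m h', hT m h (by omega), hT (m + 1) (by omega) h'⟩).trans ?_
      exact reflTransGen_semiStep_of_dir hby fun v hv hbv =>
        ⟨hv, fun h => hDa _ (TransGen.tail ((hDtrans i n (by omega) le_rfl).trans_left
          (ReflTransGen.mono hsub _ _ hbv)) (hsub _ _ h))⟩
  exact ⟨f n, hn, reflTransGen_of_walk n.zero_le fun m _ hm =>
    ⟨hundir (n - m - 1) m (by omega), hX' n 0 (by omega) m m.zero_le hm.le,
      hX' n 0 (by omega) (m + 1) (by omega) hm⟩⟩

theorem isUndirPath_reflTransGen {p : List V} {a b : V} (hp : G.IsUndirPath p)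
    (ha : p.head? = some a) (hb : p.getLast? = some b) : ReflTransGen G.undir a b := by
  have := List.relationReflTransGen_of_exists_isChain p hp.2.2 hp.1
  rwa [List.head_of_head?_eq_some ha, List.getLast_of_getLast?_eq_some hb] at this

theorem exists_isUndirPath {a b : V} (h : ReflTransGen G.undir a b) :
    ∃ p, G.IsUndirPath p ∧ p.head? = some a ∧ p.getLast? = some b := by
  obtain ⟨n, f, rfl, rfl, hs, hinj, -⟩ := exists_shortest_walk (· = a) (· = b) rfl rfl h
  refine ⟨List.ofFn fun i : Fin (n + 1) => f i, ⟨by simp, ?_, ?_⟩, ?_, ?_⟩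
  · rw [List.nodup_ofFn]
    intro i j h
    rcases lt_trichotomy i j with hij | hij | hij
    · exact absurd h (hinj i j hij (by omega))
    · exact hij
    · exact absurd h.symm (hinj j i hij (by omega))
  · show List.IsChain _ _
    rw [List.isChain_iff_getElem]
    intro i hi
    rw [List.length_ofFn] at hi
    simpa [-List.ofFn_succ] using hs i (by omega)
  · simp [List.ofFn_succ]
  · simp [List.getLast?_eq_getElem?, -List.ofFn_succ]

theorem Bucket.reflTransGen {B A : Finset V} (h : G.Bucket B A) {a b : V} (ha : a ∈ B)
    (hb : b ∈ B) : ReflTransGen G.undir a b := by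
  by_cases hab : a = b
  · exact hab ▸ .refl
  · obtain ⟨p, hp, hpa, hpb⟩ := h.2.2.1 a ha b hb hab
    exact isUndirPath_reflTransGen hp hpa hpb

theorem Bucket.mem_of_reflTransGen {B A : Finset V} (h : G.Bucket B A) {a b : V} (ha : a ∈ A)
    (hb : b ∈ B) (hab : ReflTransGen G.undir a b) : a ∈ B := by
  classical
  have : Std.Symm G.undir := ⟨G.undir_symm⟩
  have key : ∀ u ∈ insert a B, ReflTransGen G.undir u b := by
    intro u hu
    rcases Finset.mem_insert.1 hu with rfl | hu
    · exact hab
    · exact h.reflTransGen hu hb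
  rw [← h.2.2.2 (insert a B) (Finset.subset_insert _ _)
    (Finset.insert_subset ha h.2.1) fun u hu v hv _ =>
      exists_isUndirPath ((key u hu).trans (ReflTransGen.stdSymm.symm _ _ (key v hv)))]
  exact Finset.mem_insert_self _ _

theorem mem_anIn_iff [Fintype V] [DecidableEq V] {a : V} :
    a ∈ G.AnIn Y (Finset.univ \ X) ↔ G.AncAvoiding X Y a := by
  simp only [AnIn, AncestorIn, Finset.mem_filter, Finset.mem_univ, true_and, Finset.mem_sdiff,
    AncAvoiding]
  constructor
  · rintro ⟨y, hy, ha, -, h⟩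
    exact ⟨ha, y, hy, h⟩
  · rintro ⟨ha, y, hy, h⟩
    refine ⟨y, hy, ha, ?_, h⟩
    rcases ReflTransGen.cases_tail h with rfl | ⟨_, -, h⟩
    · exact ha
    · exact h.2.2

theorem mem_foldr_union [DecidableEq V] {Bs : List (Finset V)} {a : V} :
    a ∈ Bs.foldr (· ∪ ·) ∅ ↔ ∃ B ∈ Bs, a ∈ B := by
  induction Bs with
  | nil => simp
  | cons B Bs ih => simp [ih]

/-- If every node reached backwards from `B` along `D` while avoiding `P ∪ Z` is not an ancestor
of `P ∪ Z`, then `P` separates `B` from `Z` once the edges out of `Z` are removed. -/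
theorem dSep_removeOutOf (hD : D.IsDAG) {B Z P : Finset V} (hBP : ∀ b ∈ B, b ∉ P ∧ b ∉ Z)
    (hanc : ∀ b ∈ B, ∀ u, ReflTransGen (fun s t => D.dir s t ∧ ¬ (s ∈ P ∨ s ∈ Z)) u b →
      ∀ q, q ∈ P ∨ q ∈ Z → ¬ TransGen D.dir u q) :
    (D.removeOutOf Z).DSep B Z P := by
  rintro p b x hb hx ⟨⟨hlen, -, hchain⟩, hhead, hlast⟩ ⟨hnc, hcol⟩
  obtain ⟨n, hn⟩ : ∃ n, p.length = n + 1 := ⟨p.length - 1, by omega⟩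
  let f : ℕ → V := fun i => p.getD i b
  have hf : ∀ i ≤ n, p[i]? = some (f i) := by
    intro i hi
    simp [f, List.getElem?_eq_getElem (show i < p.length by omega)]
  have hf0 : f 0 = b := by
    have := hf 0 (by omega)
    rw [← List.head?_eq_getElem?, hhead] at this
    exact (Option.some.inj this).symm
  have hfn : f n = x := by
    have := hf n le_rfl
    rw [show n = p.length - 1 by omega, ← List.getLast?_eq_getElem?, hlast] at this
    simpa [hn] using (Option.some.inj this).symm
  have hs : ∀ i < n, (D.removeOutOf Z).dir (f i) (f (i + 1)) ∨
      (D.removeOutOf Z).dir (f (i + 1)) (f i) := by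
    intro i hi
    have h := List.isChain_iff_getElem.1 hchain i (by omega)
    have h1 := hf i (by omega)
    have h2 := hf (i + 1) (by omega)
    rw [List.getElem?_eq_getElem (by omega), Option.some.injEq] at h1 h2
    rw [h1, h2] at h
    rcases h with h | h | h
    · exact .inl h
    · exact .inr h
    · exact absurd h (hD.1 _ _)
  have hforw : ∀ k i, i + k + 1 = n → (D.removeOutOf Z).dir (f i) (f (i + 1)) →
      ∃ q, (q ∈ P ∨ q ∈ Z) ∧ TransGen D.dir (f i) q := by
    intro k
    induction k with
    | zero =>
      rintro i rfl h
      exact ⟨x, .inr hx, .single (hfn ▸ h.1)⟩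
    | succ k ih =>
      intro i hi h
      rcases hs (i + 1) (by omega) with h' | h'
      · obtain ⟨q, hq, hr⟩ := ih (i + 1) (by omega) h'
        exact ⟨q, hq, .head h.1 hr⟩
      · obtain ⟨q, hq, hr⟩ := hcol (i + 1) (f (i + 1))
          ⟨f i, f (i + 1), f (i + 2), hf i (by omega), hf (i + 1) (by omega),
            hf (i + 2) (by omega), by omega, h, h'⟩ (hf (i + 1) (by omega))
        exact ⟨q, .inl hq, TransGen.head' h.1 (ReflTransGen.mono (fun _ _ h => h.1) _ _ hr)⟩
  have hback : ∀ i ≤ n, ¬ (f i ∈ P ∨ f i ∈ Z) ∧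
      ReflTransGen (fun s t => D.dir s t ∧ ¬ (s ∈ P ∨ s ∈ Z)) (f i) b := by
    intro i
    induction i with
    | zero => exact fun _ => hf0.symm ▸ ⟨not_or.2 (hBP b hb), .refl⟩
    | succ i ih =>
      intro hi
      obtain ⟨hiQ, hr⟩ := ih (by omega)
      rcases hs i hi with h | h
      · obtain ⟨q, hq, hr'⟩ := hforw (n - i - 1) i (by omega) h
        exact absurd hr' (hanc b hb _ hr q hq)
      · have hlt : i + 1 < n := by
          refine hi.lt_of_ne fun he => h.2 ?_
          rw [he, hfn]
          exact hx
        have hP : f (i + 1) ∉ P := by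
          refine hnc (i + 1) _ (by omega) (by omega) (hf _ hi) ?_
          rintro ⟨u, v, w, hu, hv, -, -, huv, -⟩
          rw [Nat.add_sub_cancel, hf i (by omega), Option.some.injEq] at hu
          rw [hf _ hi, Option.some.injEq] at hv
          rw [← hu, ← hv] at huv
          exact D.dir_asymm _ _ h.1 huv.1
        have hQ : ¬ (f (i + 1) ∈ P ∨ f (i + 1) ∈ Z) := not_or.2 ⟨hP, h.2⟩
        exact ⟨hQ, hr.head ⟨h.1, hQ⟩⟩
  exact (hback n le_rfl).1 (.inr (hfn ▸ hx))

end PDG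

/-- `B_i` is d-separated from `X_{p_i}` given `P_i` in `D_{X̲_{p_i}}`,
for every DAG `D` in `[G]`. -/
theorem stmt13 {V : Type} [Fintype V] [DecidableEq V]
    (G : PDG V) (hG : G.IsMPDAG) (X Y : Finset V) (hXY : Disjoint X Y)
    (hno : G.NoProperPCUndirStart X Y)
    (Bs : List (Finset V)) (hk : Bs ≠ [])
    (hdec : G.IsBucketDecompList (G.AnIn Y (Finset.univ \ X)) Bs)
    (hord : G.OrderedDecomp Bs)
    (D : PDG V) (hD : D.InClassOf G)
    (i : Fin Bs.length) :
    (D.removeOutOf (X ∩ G.PaFin (Bs.get i))).DSep (Bs.get i)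
      (X ∩ G.PaFin (Bs.get i))
      (((Bs.take (i : ℕ)).foldr (· ∪ ·) ∅) ∩ G.PaFin (Bs.get i)) := by
  classical
  obtain ⟨hbucket, -, hunion⟩ := hdec
  set B := Bs.get i with hBdef
  have hBA : G.Bucket B _ := hbucket B (List.get_mem _ _)
  have hBanc : ∀ b ∈ B, G.AncAvoiding X Y b := fun b hb => mem_anIn_iff.1 (hBA.2.1 hb)
  have hPa : ∀ q, q ∈ G.PaFin B ↔ (∃ b ∈ B, G.dir q b) ∧ q ∉ B := by
    intro q
    simp [PaFin]
  have hcover : ∀ q ∈ G.PaFin B,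
      q ∈ ((Bs.take (i : ℕ)).foldr (· ∪ ·) ∅) ∩ G.PaFin B ∨ q ∈ X ∩ G.PaFin B := by
    intro q hq
    by_cases hqX : q ∈ X
    · exact .inr (Finset.mem_inter.2 ⟨hqX, hq⟩)
    refine .inl (Finset.mem_inter.2 ⟨?_, hq⟩)
    obtain ⟨⟨b, hb, hqb⟩, hqB⟩ := (hPa q).1 hq
    obtain ⟨hbX, y, hy, hby⟩ := hBanc b hb
    have hqA : q ∈ G.AnIn Y (Finset.univ \ X) :=
      mem_anIn_iff.2 ⟨hqX, y, hy, hby.head ⟨hqb, hqX, hbX⟩⟩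
    rw [← hunion, mem_foldr_union] at hqA
    obtain ⟨B', hB', hqB'⟩ := hqA
    obtain ⟨j, rfl⟩ := List.get_of_mem hB'
    refine mem_foldr_union.2 ⟨Bs.get j, ?_, hqB'⟩
    rcases lt_trichotomy j i with hji | rfl | hij
    · rw [List.mem_take_iff_getElem]
      exact ⟨j, by simpa using hji, rfl⟩
    · exact absurd hqB' hqB
    · exact absurd (hord i j hij b hb q hqB' (.inr (.inl hqb))) (G.dir_asymm _ _ hqb)
  have hdirall : ∀ q ∈ G.PaFin B, ∀ b ∈ B, ∀ c,
      ReflTransGen (G.UndirStep (· ∉ X)) b c → G.dir q c := by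
    intro q hq b hb c hbc
    obtain ⟨⟨b', hb', hqb⟩, hqB⟩ := (hPa q).1 hq
    have hb'c := (hG.reflTransGen_undirStep_of_ancAvoiding hno (hBanc b' hb') (hBanc b hb)
      (hBA.reflTransGen hb' hb)).trans hbc
    by_cases hqX : q ∈ X
    · exact hG.dir_of_dir_ancAvoiding hno hqX (hBanc b' hb') hqb hb'c
    · refine hG.dir_of_reflTransGen_undirStep hqb (fun w hw hqw => hqB ?_) hb'c
      obtain ⟨hbX, y, hy, hby⟩ := hBanc b' hb'
      refine hBA.mem_of_reflTransGen
        (mem_anIn_iff.2 ⟨hqX, y, hy, hby.head ⟨hqb, hqX, hbX⟩⟩) hb' ?_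
      exact ReflTransGen.head hqw
        (ReflTransGen.mono (fun _ _ h => h.1) _ _ (reflTransGen_undirStep_symm hw))
  have hsub : ∀ q, q ∈ ((Bs.take (i : ℕ)).foldr (· ∪ ·) ∅) ∩ G.PaFin B ∨
      q ∈ X ∩ G.PaFin B → q ∈ G.PaFin B := fun q hq =>
    hq.elim (fun h => (Finset.mem_inter.1 h).2) fun h => (Finset.mem_inter.1 h).2
  refine dSep_removeOutOf hD.1 (fun b hb => ?_) fun b hb u hub q hq huq => ?_
  · exact not_or.1 fun h => ((hPa b).1 (hsub b h)).2 hb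
  · obtain ⟨b', hb', hub'⟩ := hG.exists_reflTransGen_undirStep hno hD (B := (· ∈ B)) hBanc
      (fun q b hb hqb hqB => hcover q ((hPa q).2 ⟨⟨b, hb, hqb⟩, hqB⟩)) hb hub
    exact hD.1.2 u (huq.tail (hD.2.2.2 _ _
      (hdirall q (hsub q hq) b' hb' u (reflTransGen_undirStep_symm hub'))))
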